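/- Distribution of the label dropped by the swap-and-reduce map at a uniform leaf of a uniform tree shape: Let k ≥ 2, let τ be uniformly distributed on 𝕋^shape_{[k]}, and independently let I be uniformly distributed on [k]; set J = J(τ, I). Then ℙ(J = 1) = 0, ℙ(J = 2) = 2/(k(2k−3)), and ℙ(J = j) = (4j−5)/(k(2k−3)) for each j ∈ {3, …, k}. Moreover, for each j ∈ {2, …, k}, conditionally given {J = j}, the reduced tree shape ϱ̃(τ, I) is uniformly distributed on 𝕋^shape_{[k]∖{j}}. -/

import Mathlib

open scoped Classical

namespace AldousTrees

/-- The edges of a tree shape with label set `A`: the internal edges in `t` together with the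
leaf edges `{a}`, `a ∈ A`. -/
def edges (A : Finset ℕ) (t : Finset (Finset ℕ)) : Finset (Finset ℕ) :=
  t ∪ A.image fun a => ({a} : Finset ℕ)

/-- `C` is a child of `E`: a maximal proper member of `edges A t` contained in `E`. -/
def IsChild (A : Finset ℕ) (t : Finset (Finset ℕ)) (C E : Finset ℕ) : Prop :=
  C ∈ edges A t ∧ C ⊂ E ∧ ∀ F ∈ edges A t, C ⊂ F → ¬ F ⊂ E

/-- `t` is (the edge-set representation of) a tree shape with label set `A`: a rooted binary
combinatorial tree with leaves labelled by `A` and root of degree one.  `t` is the collection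
of internal edges, each represented by the set of leaf labels above it. -/
structure IsTreeShape (A : Finset ℕ) (t : Finset (Finset ℕ)) : Prop where
  nonempty_ground : A.Nonempty
  subset_ground : ∀ E ∈ t, E ⊆ A
  two_le_card : ∀ E ∈ t, 2 ≤ E.card
  ground_mem : 2 ≤ A.card → A ∈ t
  nested_or_disjoint : ∀ E ∈ edges A t, ∀ F ∈ edges A t, E ⊆ F ∨ F ⊆ E ∨ Disjoint E F
  binary : ∀ E ∈ t, ∃ C₁ C₂, IsChild A t C₁ E ∧ IsChild A t C₂ E ∧ C₁ ≠ C₂ ∧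
    Disjoint C₁ C₂ ∧ C₁ ∪ C₂ = E ∧ ∀ C, IsChild A t C E → C = C₁ ∨ C = C₂

/-- The number of children of the internal edge `E` that are leaf edges; an internal edge is of
type `d` if exactly `d` of its two children are leaf edges. -/
noncomputable def leafChildCount (A : Finset ℕ) (t : Finset (Finset ℕ)) (E : Finset ℕ) : ℕ :=
  ((A.image fun a => ({a} : Finset ℕ)).filter fun C => IsChild A t C E).card

end AldousTrees

namespace AldousTrees

noncomputable section

/-- The smallest label of an edge (`0` for the empty set). -/
def minLabel (E : Finset ℕ) : ℕ := sInf (E : Set ℕ)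

/-- The relabelling map `φ_{𝐭,i}`: from a label set, first delete `i`, then replace `j`
by `i` (if present). -/
def relabel (i j : ℕ) (E : Finset ℕ) : Finset ℕ :=
  if j ∈ E.erase i then insert i ((E.erase i).erase j) else E.erase i

/-- The parent edge `parent(E) = ⋂ {F ∈ t : E ⊊ F}` of `E` (computed inside the ground set
`⋃ t`; it equals `⋃ t` if no edge strictly contains `E`). -/
def parentEdge (t : Finset (Finset ℕ)) (E : Finset ℕ) : Finset ℕ :=
  (t.sup id).filter fun x => ∀ F ∈ t, E ⊂ F → x ∈ F

/-- `J(𝐭,i) = max {i, a, b}`, where `a` is the smallest label of the sibling of the leaf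
edge `{i}` and `b` is the smallest label of its uncle (`b = 0` if `parent({i}) = A`).  In a
tree shape the sibling of `{i}` is `parent({i}) ∖ {i}` and the uncle is
`parent(parent({i})) ∖ parent({i})`. -/
def Jmap (A : Finset ℕ) (t : Finset (Finset ℕ)) (i : ℕ) : ℕ :=
  letI P := parentEdge t {i}
  max i (max (minLabel (P \ {i}))
    (if P = A then 0 else minLabel (parentEdge t P \ P)))

/-- The swap-and-reduce map `ϱ̃(𝐭,i)` on tree shapes: the image of `𝐭 ∖ {parent({i})}`
under `φ_{𝐭,i}` (delete `i`, then replace `j = J(𝐭,i)` by `i`). -/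
def reducedShape (t : Finset (Finset ℕ)) (i j : ℕ) : Finset (Finset ℕ) :=
  (t.erase (parentEdge t {i})).image (relabel i j)

/-- The (finite) set `𝕋^shape_A` of all tree shapes with label set `A`. -/
def shapesOn (A : Finset ℕ) : Finset (Finset (Finset ℕ)) :=
  A.powerset.powerset.filter fun t => IsTreeShape A t

variable {A : Finset ℕ} {t : Finset (Finset ℕ)} {i j : ℕ} {E F P : Finset ℕ}

theorem mem_edges : E ∈ edges A t ↔ E ∈ t ∨ ∃ a ∈ A, {a} = E := by
  simp [edges]

theorem IsTreeShape.subset_of_mem_edges (h : IsTreeShape A t) (hE : E ∈ edges A t) : E ⊆ A := by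
  rcases mem_edges.1 hE with hE | ⟨a, ha, rfl⟩
  · exact h.subset_ground E hE
  · simpa using ha

theorem IsTreeShape.nonempty_of_mem_edges (h : IsTreeShape A t) (hE : E ∈ edges A t) :
    E.Nonempty := by
  rcases mem_edges.1 hE with hE | ⟨a, ha, rfl⟩
  · exact Finset.card_pos.1 (by have := h.two_le_card E hE; omega)
  · simp

theorem IsTreeShape.mem_of_mem_edges (hE : E ∈ edges A t) (hc : 2 ≤ E.card) : E ∈ t := by
  rcases mem_edges.1 hE with hE | ⟨a, ha, rfl⟩
  · exact hE
  · simp at hc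

theorem IsTreeShape.ground_mem_edges (h : IsTreeShape A t) : A ∈ edges A t := by
  rcases Nat.lt_or_ge A.card 2 with hc | hc
  · have h1 : A.card = 1 := by have := Finset.card_pos.2 h.nonempty_ground; omega
    obtain ⟨a, rfl⟩ := Finset.card_eq_one.1 h1
    exact mem_edges.2 (Or.inr ⟨a, by simp, rfl⟩)
  · exact mem_edges.2 (Or.inl (h.ground_mem hc))

theorem IsTreeShape.exists_split (h : IsTreeShape A t) (hE : E ∈ edges A t) (hc : 2 ≤ E.card) :
    ∃ C ∈ edges A t, C ⊂ E ∧ E \ C ∈ edges A t := by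
  obtain ⟨C, D, hC, hD, -, hCD, rfl, -⟩ := h.binary E (mem_of_mem_edges hE hc)
  refine ⟨C, hC.1, hC.2.1, ?_⟩
  rw [Finset.union_sdiff_cancel_left hCD]
  exact hD.1

/-- In a laminar family, an edge properly inside `E = C ∪ (E \ C)` lies in one of the halves. -/
theorem subset_or_subset_sdiff {C : Finset ℕ} {T : Finset (Finset ℕ)}
    (hT : ∀ E ∈ T, ∀ F ∈ T, E ⊆ F ∨ F ⊆ E ∨ Disjoint E F)
    (hC : C ∈ T) (hCE : C ⊂ E) (hD : E \ C ∈ T) (hF : F ∈ T) (hFE : F ⊂ E) :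
    F ⊆ C ∨ F ⊆ E \ C := by
  have h1 := hT F hF C hC
  have h2 := hT F hF _ hD
  simp only [Finset.ssubset_iff_subset_ne, Finset.disjoint_left, Finset.subset_iff, ne_eq,
    Finset.ext_iff, Finset.mem_sdiff] at *
  grind

theorem IsTreeShape.of_edges (hA : A.Nonempty) (hc : ∀ E ∈ t, 2 ≤ E.card)
    (hs : ∀ E ∈ edges A t, E ⊆ A) (hg : A ∈ edges A t)
    (hl : ∀ E ∈ edges A t, ∀ F ∈ edges A t, E ⊆ F ∨ F ⊆ E ∨ Disjoint E F)
    (hb : ∀ E ∈ edges A t, 2 ≤ E.card → ∃ C ∈ edges A t, C ⊂ E ∧ E \ C ∈ edges A t) :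
    IsTreeShape A t := by
  have hne : ∀ E ∈ edges A t, E.Nonempty := by
    intro E hE
    rcases mem_edges.1 hE with hE | ⟨a, ha, rfl⟩
    · exact Finset.card_pos.1 (by have := hc E hE; omega)
    · simp
  refine ⟨hA, fun E hE => hs E (mem_edges.2 (Or.inl hE)), hc,
    fun h => IsTreeShape.mem_of_mem_edges hg h, hl, fun E hE => ?_⟩
  obtain ⟨C, hC, hCE, hD⟩ := hb E (mem_edges.2 (Or.inl hE)) (hc E hE)
  have hCne := hne _ hC
  have hDne := hne _ hD
  have hDE : E \ C ⊂ E := Finset.sdiff_ssubset hCE.1 hCne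
  have key : ∀ F ∈ edges A t, F ⊂ E → F ⊆ C ∨ F ⊆ E \ C :=
    fun F hF hFE => subset_or_subset_sdiff hl hC hCE hD hF hFE
  have hdis : Disjoint C (E \ C) := Finset.disjoint_sdiff
  have hneq : C ≠ E \ C := by
    intro h
    rw [← h] at hdis
    exact hCne.ne_empty (by simpa using hdis)
  refine ⟨C, E \ C, ⟨hC, hCE, ?_⟩, ⟨hD, hDE, ?_⟩, hneq, hdis,
    Finset.union_sdiff_of_subset hCE.1, ?_⟩
  · intro F hF hCF hFE
    rcases key F hF hFE with h | h
    · exact hCF.2 h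
    · exact hCne.ne_empty ((Finset.disjoint_self_iff_empty _).1
        (hdis.mono_right (hCF.1.trans h)))
  · intro F hF hCF hFE
    rcases key F hF hFE with h | h
    · exact hDne.ne_empty ((Finset.disjoint_self_iff_empty _).1
        (hdis.mono_left (hCF.1.trans h)))
    · exact hCF.2 h
  · rintro F ⟨hF, hFE, hmax⟩
    rcases key F hF hFE with h | h
    · left
      by_contra hh
      exact hmax C hC (Finset.ssubset_iff_subset_ne.2 ⟨h, hh⟩) hCE
    · right
      by_contra hh
      exact hmax _ hD (Finset.ssubset_iff_subset_ne.2 ⟨h, hh⟩) hDE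

/-- `P` is the least internal edge strictly containing `E`. -/
def IsParent (t : Finset (Finset ℕ)) (E P : Finset ℕ) : Prop :=
  P ∈ t ∧ E ⊂ P ∧ ∀ F ∈ t, E ⊂ F → P ⊆ F

theorem IsParent.parentEdge_eq (h : IsParent t E P) : parentEdge t E = P := by
  ext x
  simp only [parentEdge, Finset.mem_filter, Finset.mem_sup, id]
  exact ⟨fun hx => hx.2 P h.1 h.2.1, fun hx => ⟨⟨P, h.1, hx⟩, fun F hF hEF => h.2.2 F hF hEF hx⟩⟩

theorem IsTreeShape.exists_isParent (h : IsTreeShape A t) (hE : E ∈ edges A t) (hEA : E ≠ A) :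
    ∃ P, IsParent t E P ∧ P \ E ∈ edges A t := by
  have hEne := h.nonempty_of_mem_edges hE
  have big : ∀ F, E ⊂ F → 2 ≤ F.card := fun F hF => by
    have := Finset.card_lt_card hF
    have := hEne.card_pos
    omega
  have hEA' : E ⊂ A := Finset.ssubset_iff_subset_ne.2 ⟨h.subset_of_mem_edges hE, hEA⟩
  have hAt : A ∈ t := h.ground_mem (big A hEA')
  obtain ⟨P, hP, hmin⟩ := Finset.exists_min_image (t.filter (E ⊂ ·)) Finset.card
    ⟨A, by simp [hAt, hEA']⟩
  rw [Finset.mem_filter] at hP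
  have hPe : P ∈ edges A t := mem_edges.2 (Or.inl hP.1)
  have hpar : IsParent t E P := by
    refine ⟨hP.1, hP.2, fun F hF hEF => ?_⟩
    rcases h.nested_or_disjoint P hPe F (mem_edges.2 (Or.inl hF)) with h1 | h1 | h1
    · exact h1
    · exact (Finset.eq_of_subset_of_card_le h1 (hmin F (by simp [hF, hEF]))).ge
    · exact absurd ((Finset.disjoint_self_iff_empty _).1
        ((h1.mono_left hP.2.1).mono_right hEF.1)) hEne.ne_empty
  refine ⟨P, hpar, ?_⟩
  obtain ⟨C, hC, hCP, hD⟩ := h.exists_split hPe (h.two_le_card P hP.1)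
  have hmax : ∀ F ∈ edges A t, F ⊂ P → E ⊆ F → E = F := by
    intro F hF hFP hEF
    by_contra hne
    have hlt : E ⊂ F := Finset.ssubset_iff_subset_ne.2 ⟨hEF, hne⟩
    exact hFP.2 (hpar.2.2 F (mem_of_mem_edges hF (big F hlt)) hlt)
  rcases subset_or_subset_sdiff h.nested_or_disjoint hC hCP hD hE hP.2 with h1 | h1
  · rw [hmax C hC hCP h1]; exact hD
  · rw [hmax _ hD (Finset.sdiff_ssubset hCP.1 (h.nonempty_of_mem_edges hC)) h1,
      Finset.sdiff_sdiff_eq_self hCP.1]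
    exact hC

/-- The sibling of the edge `E`; it is empty if `E` is the root edge. -/
def sibling (t : Finset (Finset ℕ)) (E : Finset ℕ) : Finset ℕ :=
  parentEdge t E \ E

theorem IsTreeShape.sibling_ground (h : IsTreeShape A t) : sibling t A = ∅ := by
  refine Finset.sdiff_eq_empty_iff_subset.2 ((Finset.filter_subset _ _).trans ?_)
  exact Finset.sup_le h.subset_ground

/-- If the edge `F` splits into `C` and `D`, then `D` is the sibling of `C`. -/
theorem IsTreeShape.sibling_eq {C : Finset ℕ} (h : IsTreeShape A t) (hF : F ∈ edges A t)
    (hC : C ∈ edges A t) (hCF : C ⊂ F) (hD : F \ C ∈ edges A t) : sibling t C = F \ C := by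
  have hCne := h.nonempty_of_mem_edges hC
  have hFt : F ∈ t := IsTreeShape.mem_of_mem_edges hF (by
    have := Finset.card_lt_card hCF
    have := hCne.card_pos
    omega)
  have hpar : IsParent t C F := by
    refine ⟨hFt, hCF, fun G hG hCG => ?_⟩
    have hGe : G ∈ edges A t := mem_edges.2 (Or.inl hG)
    by_contra hFG
    have hGF : G ⊂ F := by
      rcases h.nested_or_disjoint F hF G hGe with h1 | h1 | h1
      · exact absurd h1 hFG
      · exact ⟨h1, hFG⟩
      · exact absurd ((Finset.disjoint_self_iff_empty _).1
          ((h1.mono_left hCF.1).mono_right hCG.1)) hCne.ne_empty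
    rcases subset_or_subset_sdiff h.nested_or_disjoint hC hCF hD hGe hGF with h1 | h1
    · exact hCG.2 h1
    · exact hCne.ne_empty ((Finset.disjoint_self_iff_empty _).1
        (Finset.disjoint_sdiff.mono_right (hCG.1.trans h1)))
  rw [sibling, hpar.parentEdge_eq]

/-- Summing a weight of (edge, sibling) pairs over the edges strictly inside `F`. -/
theorem IsTreeShape.sum_sibling (h : IsTreeShape A t) (f : Finset ℕ → ℕ)
    (w : Finset ℕ → Finset ℕ → ℕ) (hf₁ : ∀ a ∈ A, f {a} = 0)
    (hf : ∀ C ∈ edges A t, ∀ D ∈ edges A t, Disjoint C D →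
      f (C ∪ D) = f C + f D + w C D + w D C) (n : ℕ) :
    ∀ F ∈ edges A t, F.card = n →
      ∑ E ∈ (edges A t).filter (· ⊂ F), w E (sibling t E) = f F := by
  induction n using Nat.strong_induction_on with
  | _ n ih =>
  intro F hF hn
  rcases Nat.lt_or_ge F.card 2 with hc | hc
  · have h1 : F.card = 1 := by have := (h.nonempty_of_mem_edges hF).card_pos; omega
    obtain ⟨a, rfl⟩ := Finset.card_eq_one.1 h1
    rw [hf₁ a (by simpa using h.subset_of_mem_edges hF), Finset.filter_false_of_mem]
    · simp
    · intro E hE hlt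
      rw [Finset.ssubset_singleton_iff] at hlt
      exact (h.nonempty_of_mem_edges hE).ne_empty hlt
  · obtain ⟨C, hC, hCF, hD⟩ := h.exists_split hF hc
    have hCne := h.nonempty_of_mem_edges hC
    have hDne := h.nonempty_of_mem_edges hD
    have hDF : F \ C ⊂ F := Finset.sdiff_ssubset hCF.1 hCne
    have hsC := h.sibling_eq hF hC hCF hD
    have hsD := h.sibling_eq hF hD hDF (by rwa [Finset.sdiff_sdiff_eq_self hCF.1])
    rw [Finset.sdiff_sdiff_eq_self hCF.1] at hsD
    have hdis : Disjoint C (F \ C) := Finset.disjoint_sdiff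
    have hsplit : (edges A t).filter (· ⊂ F) =
        insert C (insert (F \ C) ((edges A t).filter (· ⊂ C) ∪
          (edges A t).filter (· ⊂ F \ C))) := by
      ext G
      simp only [Finset.mem_filter, Finset.mem_insert, Finset.mem_union]
      constructor
      · rintro ⟨hG, hGF⟩
        rcases subset_or_subset_sdiff h.nested_or_disjoint hC hCF hD hG hGF with h1 | h1
        · rcases eq_or_ne G C with h2 | h2
          · exact Or.inl h2
          · exact Or.inr (Or.inr (Or.inl ⟨hG, Finset.ssubset_iff_subset_ne.2 ⟨h1, h2⟩⟩))
        · rcases eq_or_ne G (F \ C) with h2 | h2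
          · exact Or.inr (Or.inl h2)
          · exact Or.inr (Or.inr (Or.inr ⟨hG, Finset.ssubset_iff_subset_ne.2 ⟨h1, h2⟩⟩))
      · rintro (rfl | rfl | ⟨hG, hGC⟩ | ⟨hG, hGC⟩)
        · exact ⟨hC, hCF⟩
        · exact ⟨hD, hDF⟩
        · exact ⟨hG, hGC.trans hCF⟩
        · exact ⟨hG, hGC.trans hDF⟩
    have disj : ∀ G ∈ edges A t, G ⊆ C → G ⊆ F \ C → False := fun G hG h1 h2 =>
      (h.nonempty_of_mem_edges hG).ne_empty ((Finset.disjoint_self_iff_empty _).1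
        ((hdis.mono_left h1).mono_right h2))
    rw [hsplit, Finset.sum_insert, Finset.sum_insert, Finset.sum_union,
      ih _ (hn ▸ Finset.card_lt_card hCF) C hC rfl,
      ih _ (hn ▸ Finset.card_lt_card hDF) _ hD rfl, hsC, hsD]
    · have := hf C hC _ hD hdis
      rw [Finset.union_sdiff_of_subset hCF.1] at this
      omega
    · rw [Finset.disjoint_left]
      intro G h1 h2
      rw [Finset.mem_filter] at h1 h2
      exact disj G h1.1 h1.2.1 h2.2.1
    · simp only [Finset.mem_union, Finset.mem_filter, not_or]
      exact ⟨fun h1 => disj _ hD h1.2.1 subset_rfl, fun h1 => h1.2.2 subset_rfl⟩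
    · simp only [Finset.mem_insert, Finset.mem_union, Finset.mem_filter, not_or]
      exact ⟨fun h1 => disj _ hC subset_rfl h1.le, fun h1 => h1.2.2 subset_rfl,
        fun h1 => disj _ hC subset_rfl h1.2.1⟩

theorem eq_of_edges_eq {t' : Finset (Finset ℕ)} (ht : ∀ E ∈ t, 2 ≤ E.card)
    (ht' : ∀ E ∈ t', 2 ≤ E.card) (h : edges A t = edges A t') : t = t' := by
  ext E
  constructor <;> intro hE
  · exact IsTreeShape.mem_of_mem_edges (h ▸ mem_edges.2 (Or.inl hE)) (ht E hE)
  · exact IsTreeShape.mem_of_mem_edges (h ▸ mem_edges.2 (Or.inl hE)) (ht' E hE)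

/-- Insert the leaf `i` on the edge `E` of the tree shape `t` with label set `A`. -/
def insertLeaf (A : Finset ℕ) (t : Finset (Finset ℕ)) (i : ℕ) (E : Finset ℕ) :
    Finset (Finset ℕ) :=
  ((edges A t).filter (E ⊆ ·)).image (insert i) ∪ t.filter (¬ E ⊂ ·)

/-- Delete the leaf `i` together with its parent edge. -/
def deleteLeaf (t : Finset (Finset ℕ)) (i : ℕ) : Finset (Finset ℕ) :=
  (t.erase (parentEdge t {i})).image (·.erase i)

theorem mem_insertLeaf {G : Finset ℕ} : G ∈ insertLeaf A t i E ↔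
    (∃ F ∈ edges A t, E ⊆ F ∧ insert i F = G) ∨ (G ∈ t ∧ ¬ E ⊂ G) := by
  simp [insertLeaf, and_assoc]

theorem IsTreeShape.mem_edges_insertLeaf (h : IsTreeShape A t) (hE : E ∈ edges A t)
    {G : Finset ℕ} : G ∈ edges (insert i A) (insertLeaf A t i E) ↔
      G = {i} ∨ (∃ F ∈ edges A t, E ⊆ F ∧ insert i F = G) ∨ (G ∈ edges A t ∧ ¬ E ⊂ G) := by
  have hsing : ∀ a, ¬ E ⊂ {a} := fun a hlt =>
    (h.nonempty_of_mem_edges hE).ne_empty (Finset.ssubset_singleton_iff.1 hlt)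
  rw [mem_edges, mem_insertLeaf, mem_edges (A := A) (E := G)]
  constructor
  · rintro ((h1 | h1) | ⟨a, ha, rfl⟩)
    · exact Or.inr (Or.inl h1)
    · exact Or.inr (Or.inr ⟨Or.inl h1.1, h1.2⟩)
    · rcases Finset.mem_insert.1 ha with rfl | ha
      · exact Or.inl rfl
      · exact Or.inr (Or.inr ⟨Or.inr ⟨a, ha, rfl⟩, hsing a⟩)
  · rintro (rfl | h1 | ⟨h1 | ⟨a, ha, rfl⟩, h2⟩)
    · exact Or.inr ⟨i, by simp, rfl⟩
    · exact Or.inl (Or.inl h1)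
    · exact Or.inl (Or.inr ⟨h1, h2⟩)
    · exact Or.inr ⟨a, by simp [ha], rfl⟩

theorem IsTreeShape.insertLeaf (h : IsTreeShape A t) (hi : i ∉ A) (hE : E ∈ edges A t) :
    IsTreeShape (insert i A) (insertLeaf A t i E) := by
  have hin : ∀ F ∈ edges A t, i ∉ F := fun F hF hiF => hi (h.subset_of_mem_edges hF hiF)
  have hEne := h.nonempty_of_mem_edges hE
  refine .of_edges (by simp) ?_ ?_ ?_ ?_ ?_
  · intro G hG
    rcases mem_insertLeaf.1 hG with ⟨F, hF, hEF, rfl⟩ | ⟨hG, -⟩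
    · rw [Finset.card_insert_of_notMem (hin F hF)]
      have := (h.nonempty_of_mem_edges hF).card_pos
      omega
    · exact h.two_le_card G hG
  · intro G hG
    rcases (h.mem_edges_insertLeaf hE).1 hG with rfl | ⟨F, hF, hEF, rfl⟩ | ⟨hG, -⟩
    · simp
    · exact Finset.insert_subset_insert _ (h.subset_of_mem_edges hF)
    · exact (h.subset_of_mem_edges hG).trans (Finset.subset_insert _ _)
  · exact (h.mem_edges_insertLeaf hE).2
      (Or.inr (Or.inl ⟨A, h.ground_mem_edges, h.subset_of_mem_edges hE, rfl⟩))
  · intro G hG G' hG'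
    obtain ⟨e, he⟩ := hEne
    rcases (h.mem_edges_insertLeaf hE).1 hG with rfl | ⟨F, hF, hEF, rfl⟩ | ⟨hG, hG2⟩ <;>
    rcases (h.mem_edges_insertLeaf hE).1 hG' with rfl | ⟨F', hF', hEF', rfl⟩ | ⟨hG', hG2'⟩
    · simp
    · simp
    · exact Or.inr (Or.inr (by simpa using hin _ hG'))
    · simp
    · rcases h.nested_or_disjoint F hF F' hF' with h1 | h1 | h1
      · exact Or.inl (Finset.insert_subset_insert _ h1)
      · exact Or.inr (Or.inl (Finset.insert_subset_insert _ h1))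
      · exact absurd (hEF' he) (Finset.disjoint_left.1 h1 (hEF he))
    · rcases h.nested_or_disjoint F hF G' hG' with h1 | h1 | h1
      · have : E = G' := by
          by_contra hne
          exact hG2' (Finset.ssubset_iff_subset_ne.2 ⟨hEF.trans h1, hne⟩)
        subst this
        exact Or.inr (Or.inl (hEF.trans (Finset.subset_insert _ _)))
      · exact Or.inr (Or.inl (h1.trans (Finset.subset_insert _ _)))
      · exact Or.inr (Or.inr (Finset.disjoint_insert_left.2 ⟨hin _ hG', h1⟩))
    · exact Or.inr (Or.inr (by simpa using hin _ hG))
    · rcases h.nested_or_disjoint F' hF' G hG with h1 | h1 | h1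
      · have : E = G := by
          by_contra hne
          exact hG2 (Finset.ssubset_iff_subset_ne.2 ⟨hEF'.trans h1, hne⟩)
        subst this
        exact Or.inl (hEF'.trans (Finset.subset_insert _ _))
      · exact Or.inl (h1.trans (Finset.subset_insert _ _))
      · exact Or.inr (Or.inr (Finset.disjoint_insert_right.2 ⟨hin _ hG, h1.symm⟩))
    · exact h.nested_or_disjoint G hG G' hG'
  · have old : ∀ C ∈ edges A t, ¬ E ⊂ C →
        C ∈ edges (insert i A) (AldousTrees.insertLeaf A t i E) :=
      fun C hC hC' => (h.mem_edges_insertLeaf hE).2 (Or.inr (Or.inr ⟨hC, hC'⟩))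
    have new : ∀ C ∈ edges A t, E ⊆ C →
        insert i C ∈ edges (insert i A) (AldousTrees.insertLeaf A t i E) :=
      fun C hC hC' => (h.mem_edges_insertLeaf hE).2 (Or.inr (Or.inl ⟨C, hC, hC', rfl⟩))
    intro G hG hc
    rcases (h.mem_edges_insertLeaf hE).1 hG with rfl | ⟨F, hF, hEF, rfl⟩ | ⟨hG, hG2⟩
    · simp at hc
    · rcases eq_or_ne E F with rfl | hne
      · refine ⟨E, old E hE (fun h1 => h1.2 subset_rfl),
          Finset.ssubset_insert (hin E hE), ?_⟩
        rw [Finset.insert_sdiff_cancel (hin E hE)]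
        exact (h.mem_edges_insertLeaf hE).2 (Or.inl rfl)
      · have hlt : E ⊂ F := Finset.ssubset_iff_subset_ne.2 ⟨hEF, hne⟩
        obtain ⟨C, hC, hCF, hD⟩ := h.exists_split hF (by
          have := Finset.card_lt_card hlt
          have := hEne.card_pos
          omega)
        have key : ∀ C ∈ edges A t, C ⊂ F → F \ C ∈ edges A t → E ⊆ C →
            ∃ C ∈ edges (insert i A) (AldousTrees.insertLeaf A t i E), C ⊂ insert i F ∧
              insert i F \ C ∈ edges (insert i A) (AldousTrees.insertLeaf A t i E) := by
          intro C hC hCF hD hEC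
          refine ⟨insert i C, new C hC hEC, ?_, ?_⟩
          · refine ⟨Finset.insert_subset_insert _ hCF.1, fun h1 => hCF.2 fun x hx => ?_⟩
            rcases Finset.mem_insert.1 (h1 (Finset.mem_insert_of_mem hx)) with rfl | h2
            · exact absurd hx (hin F hF)
            · exact h2
          · have : insert i F \ insert i C = F \ C := by
              have := hin F hF
              ext x
              simp only [Finset.mem_sdiff, Finset.mem_insert]
              grind
            rw [this]
            refine old _ hD fun h1 => ?_
            obtain ⟨e, he⟩ := hEne
            exact (Finset.mem_sdiff.1 (h1.1 he)).2 (hEC he)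
        rcases subset_or_subset_sdiff h.nested_or_disjoint hC hCF hD hE hlt with h1 | h1
        · exact key C hC hCF hD h1
        · exact key _ hD (Finset.sdiff_ssubset hCF.1 (h.nonempty_of_mem_edges hC))
            (by rwa [Finset.sdiff_sdiff_eq_self hCF.1]) h1
    · obtain ⟨C, hC, hCG, hD⟩ := h.exists_split hG hc
      have hDG : G \ C ⊂ G := Finset.sdiff_ssubset hCG.1 (h.nonempty_of_mem_edges hC)
      exact ⟨C, old C hC (fun h1 => hG2 (h1.trans hCG)), hCG,
        old _ hD (fun h1 => hG2 (h1.trans hDG))⟩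

theorem IsTreeShape.isParent_insertLeaf_singleton (h : IsTreeShape A t) (hi : i ∉ A)
    (hE : E ∈ edges A t) : IsParent (AldousTrees.insertLeaf A t i E) {i} (insert i E) := by
  have hin : ∀ F ∈ edges A t, i ∉ F := fun F hF hiF => hi (h.subset_of_mem_edges hF hiF)
  refine ⟨mem_insertLeaf.2 (Or.inl ⟨E, hE, subset_rfl, rfl⟩), ?_, ?_⟩
  · obtain ⟨e, he⟩ := h.nonempty_of_mem_edges hE
    refine Finset.ssubset_iff_subset_ne.2 ⟨by simp, fun h1 => hin E hE ?_⟩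
    have : e ∈ ({i} : Finset ℕ) := h1 ▸ Finset.mem_insert_of_mem he
    rwa [← Finset.mem_singleton.1 this]
  · intro G hG hiG
    rcases mem_insertLeaf.1 hG with ⟨F, hF, hEF, rfl⟩ | ⟨hG, -⟩
    · exact Finset.insert_subset_insert _ hEF
    · exact absurd (hiG.1 (Finset.mem_singleton_self i)) (hin G (mem_edges.2 (Or.inl hG)))

theorem IsTreeShape.isParent_insertLeaf (h : IsTreeShape A t) (hi : i ∉ A)
    (hE : E ∈ edges A t) (hP : IsParent t E P) :
    IsParent (AldousTrees.insertLeaf A t i E) (insert i E) (insert i P) := by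
  have hin : ∀ F ∈ edges A t, i ∉ F := fun F hF hiF => hi (h.subset_of_mem_edges hF hiF)
  have hPe : P ∈ edges A t := mem_edges.2 (Or.inl hP.1)
  have hss : ∀ F ∈ edges A t, insert i E ⊂ insert i F → E ⊂ F := by
    intro F hF h1
    rw [Finset.ssubset_iff_subset_ne] at h1 ⊢
    refine ⟨(Finset.insert_subset_insert_iff (hin E hE)).1 h1.1, ?_⟩
    rintro rfl
    exact h1.2 rfl
  refine ⟨mem_insertLeaf.2 (Or.inl ⟨P, hPe, hP.2.1.1, rfl⟩), ?_, ?_⟩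
  · exact ⟨Finset.insert_subset_insert _ hP.2.1.1,
      fun h1 => hP.2.1.2 ((Finset.insert_subset_insert_iff (hin P hPe)).1 h1)⟩
  · intro G hG hiG
    rcases mem_insertLeaf.1 hG with ⟨F, hF, hEF, rfl⟩ | ⟨hG, -⟩
    · refine Finset.insert_subset_insert _ ?_
      have hlt := hss F hF hiG
      refine hP.2.2 F (IsTreeShape.mem_of_mem_edges hF ?_) hlt
      have := Finset.card_lt_card hlt
      have := (h.nonempty_of_mem_edges hE).card_pos
      omega
    · exact absurd (hiG.1 (Finset.mem_insert_self i E)) (hin G (mem_edges.2 (Or.inl hG)))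

theorem IsTreeShape.sibling_insertLeaf (h : IsTreeShape A t) (hi : i ∉ A)
    (hE : E ∈ edges A t) :
    sibling (AldousTrees.insertLeaf A t i E) (insert i E) = sibling t E := by
  rcases eq_or_ne E A with rfl | hEA
  · rw [h.sibling_ground, (h.insertLeaf hi hE).sibling_ground]
  · obtain ⟨P, hP, -⟩ := h.exists_isParent hE hEA
    rw [sibling, sibling, hP.parentEdge_eq, (h.isParent_insertLeaf hi hE hP).parentEdge_eq]
    have : i ∉ P := fun h1 => hi (h.subset_ground P hP.1 h1)
    ext x
    simp only [Finset.mem_sdiff, Finset.mem_insert]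
    grind

theorem IsTreeShape.Jmap_eq (h : IsTreeShape A t) : Jmap A t i =
    max i (max (minLabel (sibling t {i})) (minLabel (sibling t (parentEdge t {i})))) := by
  simp only [Jmap, sibling]
  split_ifs with h1
  · have := h.sibling_ground
    rw [sibling] at this
    rw [h1, this]
    simp [minLabel]
  · rfl

theorem IsTreeShape.sibling_singleton_insertLeaf (h : IsTreeShape A t) (hi : i ∉ A)
    (hE : E ∈ edges A t) : sibling (AldousTrees.insertLeaf A t i E) {i} = E := by
  rw [sibling, (h.isParent_insertLeaf_singleton hi hE).parentEdge_eq]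
  have : i ∉ E := fun h1 => hi (h.subset_of_mem_edges hE h1)
  ext x
  simp only [Finset.mem_sdiff, Finset.mem_insert, Finset.mem_singleton]
  grind

theorem IsTreeShape.Jmap_insertLeaf (h : IsTreeShape A t) (hi : i ∉ A)
    (hE : E ∈ edges A t) : Jmap (insert i A) (AldousTrees.insertLeaf A t i E) i =
      max i (max (minLabel E) (minLabel (sibling t E))) := by
  rw [(h.insertLeaf hi hE).Jmap_eq, h.sibling_singleton_insertLeaf hi hE,
    (h.isParent_insertLeaf_singleton hi hE).parentEdge_eq, h.sibling_insertLeaf hi hE]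

theorem IsTreeShape.deleteLeaf_insertLeaf (h : IsTreeShape A t) (hi : i ∉ A)
    (hE : E ∈ edges A t) : deleteLeaf (AldousTrees.insertLeaf A t i E) i = t := by
  have hin : ∀ F ∈ edges A t, i ∉ F := fun F hF hiF => hi (h.subset_of_mem_edges hF hiF)
  have hEne := h.nonempty_of_mem_edges hE
  ext G
  rw [deleteLeaf, (h.isParent_insertLeaf_singleton hi hE).parentEdge_eq]
  simp only [Finset.mem_image, Finset.mem_erase, mem_insertLeaf]
  constructor
  · rintro ⟨F, ⟨hne, ⟨F, hF, hEF, rfl⟩ | ⟨hF, -⟩⟩, rfl⟩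
    · rw [Finset.erase_insert (hin F hF)]
      refine IsTreeShape.mem_of_mem_edges hF ?_
      have hlt : E ⊂ F := Finset.ssubset_iff_subset_ne.2 ⟨hEF, fun h1 => hne (h1 ▸ rfl)⟩
      have := Finset.card_lt_card hlt
      have := hEne.card_pos
      omega
    · rwa [Finset.erase_eq_of_notMem (hin F (mem_edges.2 (Or.inl hF)))]
  · intro hG
    have hGe : G ∈ edges A t := mem_edges.2 (Or.inl hG)
    by_cases hEG : E ⊂ G
    · refine ⟨insert i G, ⟨fun h1 => hEG.2 ?_, Or.inl ⟨G, hGe, hEG.1, rfl⟩⟩,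
        Finset.erase_insert (hin G hGe)⟩
      rw [← Finset.insert_subset_insert_iff (hin G hGe), h1]
    · exact ⟨G, ⟨fun h1 => hin G hGe (h1 ▸ Finset.mem_insert_self i E), Or.inr ⟨hG, hEG⟩⟩,
        Finset.erase_eq_of_notMem (hin G hGe)⟩

/-- In a tree shape with at least two leaves, the leaf `i` has a parent and a sibling edge. -/
theorem IsTreeShape.exists_parent_leaf (h : IsTreeShape A t) (hi : i ∈ A) (hA : 2 ≤ A.card) :
    IsParent t {i} (parentEdge t {i}) ∧ parentEdge t {i} \ {i} ∈ edges A t := by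
  obtain ⟨P, hP, hs⟩ := h.exists_isParent (E := {i}) (mem_edges.2 (Or.inr ⟨i, hi, rfl⟩))
    (by rintro rfl; simp at hA)
  rw [hP.parentEdge_eq]
  exact ⟨hP, hs⟩

theorem IsTreeShape.mem_edges_deleteLeaf (h : IsTreeShape A t) (hi : i ∈ A) (hA : 2 ≤ A.card)
    {G : Finset ℕ} : G ∈ edges (A.erase i) (deleteLeaf t i) ↔
      ∃ F ∈ edges A t, F ≠ {i} ∧ F.erase i = G := by
  obtain ⟨hP, hs⟩ := h.exists_parent_leaf hi hA
  set P := parentEdge t {i} with hPdef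
  have hiP : i ∈ P := hP.2.1.1 (by simp)
  rw [mem_edges]
  simp only [deleteLeaf, Finset.mem_image, Finset.mem_erase, ← hPdef]
  constructor
  · rintro (⟨F, ⟨hF1, hF2⟩, rfl⟩ | ⟨a, ⟨hai, ha⟩, rfl⟩)
    · refine ⟨F, mem_edges.2 (Or.inl hF2), ?_, rfl⟩
      rintro rfl
      simpa using h.two_le_card _ hF2
    · refine ⟨{a}, mem_edges.2 (Or.inr ⟨a, ha, rfl⟩), by simpa using hai, ?_⟩
      exact Finset.erase_eq_of_notMem (by simpa using hai.symm)
  · rintro ⟨F, hF, hne, rfl⟩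
    have hiF : ∀ a, ({a} : Finset ℕ) ≠ {i} → i ∉ ({a} : Finset ℕ) := by
      intro a ha h1
      exact ha (by rw [Finset.mem_singleton.1 h1])
    rcases mem_edges.1 hF with hFt | ⟨a, ha, rfl⟩
    · rcases eq_or_ne F P with rfl | hFP
      · rw [Finset.sdiff_singleton_eq_erase] at hs
        rcases mem_edges.1 hs with hst | ⟨a, ha, h1⟩
        · exact Or.inl ⟨P.erase i, ⟨fun h1 => Finset.erase_ne_self.2 hiP h1, hst⟩, by simp⟩
        · refine Or.inr ⟨a, ⟨?_, ha⟩, h1⟩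
          rintro rfl
          exact Finset.notMem_erase a P (h1 ▸ Finset.mem_singleton_self a)
      · exact Or.inl ⟨F, ⟨hFP, hFt⟩, rfl⟩
    · exact Or.inr ⟨a, ⟨fun h1 => hne (h1 ▸ rfl), ha⟩,
        (Finset.erase_eq_of_notMem (hiF a hne)).symm⟩

theorem IsTreeShape.two_le_card_deleteLeaf (h : IsTreeShape A t) (hi : i ∈ A)
    (hA : 2 ≤ A.card) : ∀ E ∈ deleteLeaf t i, 2 ≤ E.card := by
  obtain ⟨hP, -⟩ := h.exists_parent_leaf hi hA
  intro G hG
  simp only [deleteLeaf, Finset.mem_image, Finset.mem_erase] at hG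
  obtain ⟨F, ⟨hFP, hF⟩, rfl⟩ := hG
  have h2 := h.two_le_card F hF
  by_cases hiF : i ∈ F
  · rw [Finset.card_erase_of_mem hiF]
    have h3 : {i} ⊂ F := Finset.ssubset_iff_subset_ne.2
      ⟨by simpa using hiF, by rintro rfl; simp at h2⟩
    have h4 := Finset.card_lt_card
      (Finset.ssubset_iff_subset_ne.2 ⟨hP.2.2 F hF h3, Ne.symm hFP⟩)
    have h5 := h.two_le_card _ hP.1
    omega
  · rwa [Finset.erase_eq_of_notMem hiF]

theorem IsTreeShape.deleteLeaf (h : IsTreeShape A t) (hi : i ∈ A) (hA : 2 ≤ A.card) :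
    IsTreeShape (A.erase i) (deleteLeaf t i) := by
  have hne : ∀ F ∈ edges A t, F.Nonempty := fun F hF => h.nonempty_of_mem_edges hF
  have mem : ∀ F ∈ edges A t, F ≠ {i} →
      F.erase i ∈ edges (A.erase i) (AldousTrees.deleteLeaf t i) :=
    fun F hF hFi => (h.mem_edges_deleteLeaf hi hA).2 ⟨F, hF, hFi, rfl⟩
  refine .of_edges ?_ (h.two_le_card_deleteLeaf hi hA) ?_ ?_ ?_ ?_
  · rw [← Finset.card_pos, Finset.card_erase_of_mem hi]
    omega
  · intro G hG
    obtain ⟨F, hF, -, rfl⟩ := (h.mem_edges_deleteLeaf hi hA).1 hG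
    exact Finset.erase_subset_erase _ (h.subset_of_mem_edges hF)
  · exact mem A h.ground_mem_edges (by rintro rfl; simp at hA)
  · intro G hG G' hG'
    obtain ⟨F, hF, -, rfl⟩ := (h.mem_edges_deleteLeaf hi hA).1 hG
    obtain ⟨F', hF', -, rfl⟩ := (h.mem_edges_deleteLeaf hi hA).1 hG'
    rcases h.nested_or_disjoint F hF F' hF' with h1 | h1 | h1
    · exact Or.inl (Finset.erase_subset_erase _ h1)
    · exact Or.inr (Or.inl (Finset.erase_subset_erase _ h1))
    · exact Or.inr (Or.inr ((h1.mono_left (Finset.erase_subset _ _)).mono_right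
        (Finset.erase_subset _ _)))
  · have avoid : ∀ F ∈ edges A t, i ∉ F → 2 ≤ F.card →
        ∃ C ∈ edges (A.erase i) (AldousTrees.deleteLeaf t i), C ⊂ F ∧
          F \ C ∈ edges (A.erase i) (AldousTrees.deleteLeaf t i) := by
      intro F hF hiF hc
      obtain ⟨C, hC, hCF, hD⟩ := h.exists_split hF hc
      have hiC : i ∉ C := fun h1 => hiF (hCF.1 h1)
      have hiD : i ∉ F \ C := fun h1 => hiF (Finset.mem_sdiff.1 h1).1
      have h1 := mem C hC (by rintro rfl; simp at hiC)
      have h2 := mem _ hD (by intro h3; simp [h3] at hiD)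
      rw [Finset.erase_eq_of_notMem hiC] at h1
      rw [Finset.erase_eq_of_notMem hiD] at h2
      exact ⟨C, h1, hCF, h2⟩
    intro G hG hc
    obtain ⟨F, hF, -, rfl⟩ := (h.mem_edges_deleteLeaf hi hA).1 hG
    by_cases hiF : i ∈ F
    · have key : ∀ C ∈ edges A t, C ⊂ F → F \ C ∈ edges A t → i ∈ C →
          ∃ C ∈ edges (A.erase i) (AldousTrees.deleteLeaf t i), C ⊂ F.erase i ∧
            F.erase i \ C ∈ edges (A.erase i) (AldousTrees.deleteLeaf t i) := by
        intro C hC hCF hD hiC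
        have hiD : i ∉ F \ C := by simp [hiC]
        have heq : F.erase i \ C.erase i = F \ C := by
          ext x
          simp only [Finset.mem_sdiff, Finset.mem_erase]
          grind
        rcases eq_or_ne C {i} with rfl | hCi
        · rw [Finset.sdiff_singleton_eq_erase] at hD hiD
          exact avoid _ hD hiD hc
        · refine ⟨C.erase i, mem C hC hCi, ?_, ?_⟩
          · refine ⟨Finset.erase_subset_erase _ hCF.1, fun h1 => hCF.2 fun x hx => ?_⟩
            rcases eq_or_ne x i with rfl | hxi
            · exact hiC
            · exact Finset.mem_of_mem_erase (h1 (Finset.mem_erase.2 ⟨hxi, hx⟩))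
          · have h2 := mem _ hD (by intro h3; simp [h3] at hiD)
            rw [Finset.erase_eq_of_notMem hiD] at h2
            rwa [heq]
      obtain ⟨C, hC, hCF, hD⟩ := h.exists_split hF (hc.trans (Finset.card_erase_le))
      by_cases hiC : i ∈ C
      · exact key C hC hCF hD hiC
      · exact key _ hD (Finset.sdiff_ssubset hCF.1 (hne C hC))
          (by rwa [Finset.sdiff_sdiff_eq_self hCF.1]) (by simp [hiF, hiC])
    · rw [Finset.erase_eq_of_notMem hiF] at hc ⊢
      exact avoid F hF hiF hc

theorem IsTreeShape.sibling_leaf_mem_edges_deleteLeaf (h : IsTreeShape A t) (hi : i ∈ A)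
    (hA : 2 ≤ A.card) : sibling t {i} ∈ edges (A.erase i) (AldousTrees.deleteLeaf t i) := by
  obtain ⟨hP, -⟩ := h.exists_parent_leaf hi hA
  refine (h.mem_edges_deleteLeaf hi hA).2 ⟨parentEdge t {i}, mem_edges.2 (Or.inl hP.1), ?_, ?_⟩
  · exact hP.2.1.ne'
  · rw [sibling, Finset.sdiff_singleton_eq_erase]

theorem IsTreeShape.insertLeaf_deleteLeaf (h : IsTreeShape A t) (hi : i ∈ A)
    (hA : 2 ≤ A.card) : AldousTrees.insertLeaf (A.erase i) (AldousTrees.deleteLeaf t i) i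
      (sibling t {i}) = t := by
  obtain ⟨hP, hs⟩ := h.exists_parent_leaf hi hA
  have hd := h.deleteLeaf hi hA
  have hsm := h.sibling_leaf_mem_edges_deleteLeaf hi hA
  have hins := hd.insertLeaf (Finset.notMem_erase i A) hsm
  have hmem : ∀ G, G ∈ edges (insert i (A.erase i)) _ ↔ _ :=
    fun G => hd.mem_edges_insertLeaf (i := i) hsm (G := G)
  simp only [h.mem_edges_deleteLeaf hi hA] at hmem
  have hsib : sibling t {i} = (parentEdge t {i}).erase i := by
    rw [sibling, Finset.sdiff_singleton_eq_erase]
  rw [Finset.sdiff_singleton_eq_erase] at hs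
  have hPe : parentEdge t {i} ∈ edges A t := mem_edges.2 (Or.inl hP.1)
  generalize parentEdge t {i} = P at *
  have hiP : i ∈ P := hP.2.1.1 (by simp)
  have hne := h.nonempty_of_mem_edges hs
  have lam : ∀ F ∈ edges A t, i ∉ F → P.erase i ⊆ F → F = P.erase i := by
    intro F hF hiF hPF
    rcases h.nested_or_disjoint F hF P hPe with h1 | h1 | h1
    · exact (Finset.subset_erase.2 ⟨h1, hiF⟩).antisymm hPF
    · exact absurd (h1 hiP) hiF
    · exact absurd ((Finset.disjoint_self_iff_empty _).1
        ((h1.mono_left hPF).mono_right (Finset.erase_subset _ _))) hne.ne_empty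
  have above : ∀ F ∈ edges A t, i ∈ F → F ≠ {i} → P ⊆ F := by
    intro F hF hiF hFi
    have hlt : {i} ⊂ F := Finset.ssubset_iff_subset_ne.2 ⟨by simpa using hiF, hFi.symm⟩
    refine hP.2.2 F (IsTreeShape.mem_of_mem_edges hF ?_) hlt
    have := Finset.card_lt_card hlt
    rw [Finset.card_singleton] at this
    omega
  refine eq_of_edges_eq (A := A) hins.two_le_card h.two_le_card ?_
  rw [hsib] at hmem ⊢
  ext G
  rw [Finset.insert_erase hi] at hmem
  rw [hmem]
  constructor
  · rintro (rfl | ⟨_, ⟨F, hF, hFi, rfl⟩, hPF, rfl⟩ | ⟨⟨F, hF, hFi, rfl⟩, hPF⟩)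
    · exact mem_edges.2 (Or.inr ⟨i, hi, rfl⟩)
    · by_cases hiF : i ∈ F
      · rwa [Finset.insert_erase hiF]
      · rw [Finset.erase_eq_of_notMem hiF] at hPF ⊢
        rw [lam F hF hiF hPF, Finset.insert_erase hiP]
        exact hPe
    · by_cases hiF : i ∈ F
      · have h1 := Finset.erase_subset_erase i (above F hF hiF hFi)
        have h2 : P.erase i = F.erase i := by
          by_contra hne
          exact hPF (Finset.ssubset_iff_subset_ne.2 ⟨h1, hne⟩)
        rwa [← h2]
      · rwa [Finset.erase_eq_of_notMem hiF]
  · intro hG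
    by_cases hGi : G = {i}
    · exact Or.inl hGi
    · by_cases hiG : i ∈ G
      · exact Or.inr (Or.inl ⟨G.erase i, ⟨G, hG, hGi, rfl⟩,
          Finset.erase_subset_erase i (above G hG hiG hGi), Finset.insert_erase hiG⟩)
      · refine Or.inr (Or.inr ⟨⟨G, hG, hGi, Finset.erase_eq_of_notMem hiG⟩, fun h1 => ?_⟩)
        exact h1.ne (lam G hG hiG h1.1).symm

theorem edges_image (e : Equiv.Perm ℕ) :
    edges (A.image e) (t.image (Finset.image e)) = (edges A t).image (Finset.image e) := by
  ext G
  simp only [mem_edges, Finset.mem_image]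
  constructor
  · rintro (⟨F, hF, rfl⟩ | ⟨_, ⟨a, ha, rfl⟩, rfl⟩)
    · exact ⟨F, Or.inl hF, rfl⟩
    · exact ⟨{a}, Or.inr ⟨a, ha, rfl⟩, by simp⟩
  · rintro ⟨F, hF, rfl⟩
    rcases hF with hF | ⟨a, ha, rfl⟩
    · exact Or.inl ⟨F, hF, rfl⟩
    · exact Or.inr ⟨e a, ⟨a, ha, rfl⟩, by simp⟩

theorem image_ssubset_image_iff (e : Equiv.Perm ℕ) : E.image e ⊂ F.image e ↔ E ⊂ F := by
  rw [Finset.ssubset_def, Finset.ssubset_def, Finset.image_subset_image_iff e.injective,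
    Finset.image_subset_image_iff e.injective]

theorem IsTreeShape.image (h : IsTreeShape A t) (e : Equiv.Perm ℕ) :
    IsTreeShape (A.image e) (t.image (Finset.image e)) := by
  refine .of_edges (h.nonempty_ground.image e) ?_ ?_ ?_ ?_ ?_
  · simp only [Finset.forall_mem_image]
    intro F hF
    rw [Finset.card_image_of_injective _ e.injective]
    exact h.two_le_card F hF
  · rw [edges_image]
    simp only [Finset.forall_mem_image]
    exact fun F hF => Finset.image_subset_image (h.subset_of_mem_edges hF)
  · rw [edges_image]
    exact Finset.mem_image_of_mem _ h.ground_mem_edges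
  · rw [edges_image]
    simp only [Finset.forall_mem_image]
    intro F hF G hG
    rw [Finset.image_subset_image_iff e.injective, Finset.image_subset_image_iff e.injective,
      Finset.disjoint_image e.injective]
    exact h.nested_or_disjoint F hF G hG
  · rw [edges_image]
    simp only [Finset.forall_mem_image]
    intro F hF hc
    rw [Finset.card_image_of_injective _ e.injective] at hc
    obtain ⟨C, hC, hCF, hD⟩ := h.exists_split hF hc
    refine ⟨C.image e, Finset.mem_image_of_mem _ hC, (image_ssubset_image_iff e).2 hCF, ?_⟩
    rw [← Finset.image_sdiff _ _ e.injective]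
    exact Finset.mem_image_of_mem _ hD

theorem IsParent.image (h : IsParent t E P) (e : Equiv.Perm ℕ) :
    IsParent (t.image (Finset.image e)) (E.image e) (P.image e) := by
  refine ⟨Finset.mem_image_of_mem _ h.1, (image_ssubset_image_iff e).2 h.2.1, ?_⟩
  simp only [Finset.forall_mem_image]
  intro F hF hEF
  rw [image_ssubset_image_iff] at hEF
  exact Finset.image_subset_image (h.2.2 F hF hEF)

theorem IsTreeShape.sibling_image (h : IsTreeShape A t) (hE : E ∈ edges A t)
    (e : Equiv.Perm ℕ) :
    sibling (t.image (Finset.image e)) (E.image e) = (sibling t E).image e := by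
  rcases eq_or_ne E A with rfl | hEA
  · rw [h.sibling_ground, (h.image e).sibling_ground, Finset.image_empty]
  · obtain ⟨P, hP, -⟩ := h.exists_isParent hE hEA
    rw [sibling, sibling, hP.parentEdge_eq, (hP.image e).parentEdge_eq,
      Finset.image_sdiff _ _ e.injective]

theorem image_swap_image_swap (E : Finset ℕ) :
    (E.image (Equiv.swap i j)).image (Equiv.swap i j) = E := by
  ext x
  simp [Finset.image_image]

theorem image_image_swap_eq_iff {s : Finset (Finset ℕ)} :
    t.image (Finset.image (Equiv.swap i j)) = s ↔
      t = s.image (Finset.image (Equiv.swap i j)) := by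
  have key : ∀ u : Finset (Finset ℕ), (u.image (Finset.image (Equiv.swap i j))).image
      (Finset.image (Equiv.swap i j)) = u := by
    intro u
    rw [Finset.image_image,
      show Finset.image (Equiv.swap i j) ∘ Finset.image (Equiv.swap i j) = id from
        funext image_swap_image_swap, Finset.image_id]
  exact ⟨fun h => by rw [← h, key], fun h => by rw [h, key]⟩

theorem image_swap_erase (hi : i ∈ A) (hj : j ∈ A) :
    (A.erase j).image (Equiv.swap i j) = A.erase i := by
  ext x
  simp only [Finset.mem_image, Finset.mem_erase]
  constructor
  · rintro ⟨y, hy, rfl⟩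
    rw [Equiv.swap_apply_def]
    grind
  · intro hx
    refine ⟨Equiv.swap i j x, ?_, by simp⟩
    rw [Equiv.swap_apply_def]
    grind

theorem mem_shapesOn : t ∈ shapesOn A ↔ IsTreeShape A t := by
  simp only [shapesOn, Finset.mem_filter, Finset.mem_powerset, and_iff_right_iff_imp]
  exact fun h E hE => Finset.mem_powerset.2 (h.subset_ground E hE)

theorem relabel_eq_image_swap (i j : ℕ) (E : Finset ℕ) :
    relabel i j E = (E.erase i).image (Equiv.swap i j) := by
  ext x
  have : x ∈ (E.erase i).image (Equiv.swap i j) ↔ Equiv.swap i j x ∈ E.erase i := by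
    constructor
    · intro hx
      obtain ⟨y, hy, rfl⟩ := Finset.mem_image.1 hx
      simpa using hy
    · intro hx
      exact Finset.mem_image.2 ⟨_, hx, by simp⟩
  rw [this, relabel, Equiv.swap_apply_def]
  split_ifs <;> simp only [Finset.mem_insert, Finset.mem_erase] at * <;> grind

theorem reducedShape_eq (t : Finset (Finset ℕ)) (i j : ℕ) :
    reducedShape t i j = (deleteLeaf t i).image (Finset.image (Equiv.swap i j)) := by
  rw [reducedShape, deleteLeaf, Finset.image_image]
  exact Finset.image_congr fun E _ => relabel_eq_image_swap i j E

theorem card_shapesOn_erase (hi : i ∈ A) (hj : j ∈ A) :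
    (shapesOn (A.erase i)).card = (shapesOn (A.erase j)).card := by
  refine Finset.card_nbij' (fun t => t.image (Finset.image (Equiv.swap i j)))
    (fun t => t.image (Finset.image (Equiv.swap i j))) ?_ ?_ ?_ ?_
  · intro t ht
    rw [Finset.mem_coe, mem_shapesOn] at ht ⊢
    have := ht.image (Equiv.swap i j)
    rwa [Equiv.swap_comm, image_swap_erase hj hi, Equiv.swap_comm] at this
  · intro t ht
    rw [Finset.mem_coe, mem_shapesOn] at ht ⊢
    have := ht.image (Equiv.swap i j)
    rwa [image_swap_erase hi hj] at this
  · exact fun t _ => (image_image_swap_eq_iff.1 rfl).symm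
  · exact fun t _ => (image_image_swap_eq_iff.1 rfl).symm

theorem shapesOn_nonempty (hA : A.Nonempty) : (shapesOn A).Nonempty := by
  induction hA using Finset.Nonempty.cons_induction with
  | singleton a =>
    refine ⟨∅, mem_shapesOn.2 (.of_edges (by simp) (by simp) ?_ ?_ ?_ ?_)⟩
    all_goals simp [edges]
  | cons a s ha hs ih =>
    obtain ⟨t, ht⟩ := ih
    rw [mem_shapesOn] at ht
    rw [Finset.cons_eq_insert]
    exact ⟨_, mem_shapesOn.2 (ht.insertLeaf ha ht.ground_mem_edges)⟩

theorem IsTreeShape.card_filter_deleteLeaf {B : Finset ℕ} {s : Finset (Finset ℕ)}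
    (h : IsTreeShape B s) (hi : i ∉ B) (j : ℕ) :
    ((shapesOn (insert i B)).filter fun t => Jmap (insert i B) t i = j ∧
      AldousTrees.deleteLeaf t i = s).card =
    ((edges B s).filter fun E =>
      max i (max (minLabel E) (minLabel (sibling s E))) = j).card := by
  have hcard : 2 ≤ (insert i B).card := by
    rw [Finset.card_insert_of_notMem hi]
    have := h.nonempty_ground.card_pos
    omega
  have hiB : i ∈ insert i B := Finset.mem_insert_self i B
  refine Finset.card_nbij' (fun t => sibling t {i})
    (fun E => AldousTrees.insertLeaf B s i E) ?_ ?_ ?_ ?_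
  · intro t ht
    rw [Finset.mem_coe, Finset.mem_filter, mem_shapesOn] at ht
    obtain ⟨ht, hJ, rfl⟩ := ht
    have hm := ht.sibling_leaf_mem_edges_deleteLeaf hiB hcard
    have hr := ht.insertLeaf_deleteLeaf hiB hcard
    rw [Finset.erase_insert hi] at hm hr
    rw [Finset.mem_coe, Finset.mem_filter]
    refine ⟨hm, ?_⟩
    rw [← h.Jmap_insertLeaf hi hm, hr, hJ]
  · intro E hE
    rw [Finset.mem_coe, Finset.mem_filter] at hE
    rw [Finset.mem_coe, Finset.mem_filter, mem_shapesOn, h.Jmap_insertLeaf hi hE.1]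
    exact ⟨h.insertLeaf hi hE.1, hE.2, h.deleteLeaf_insertLeaf hi hE.1⟩
  · intro t ht
    rw [Finset.mem_coe, Finset.mem_filter, mem_shapesOn] at ht
    obtain ⟨ht, hJ, rfl⟩ := ht
    have hr := ht.insertLeaf_deleteLeaf hiB hcard
    rwa [Finset.erase_insert hi] at hr
  · intro E hE
    rw [Finset.mem_coe, Finset.mem_filter] at hE
    exact h.sibling_singleton_insertLeaf hi hE.1

theorem card_filter_reducedShape {s : Finset (Finset ℕ)} (hi : i ∈ A) (hj : j ∈ A)
    (h : IsTreeShape (A.erase j) s) :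
    ((shapesOn A).filter fun t => Jmap A t i = j ∧ reducedShape t i j = s).card =
    ((edges (A.erase j) s).filter fun E => max i (max (minLabel (E.image (Equiv.swap i j)))
      (minLabel ((sibling s E).image (Equiv.swap i j)))) = j).card := by
  have h' := h.image (Equiv.swap i j)
  have := edges_image (A := A.erase j) (t := s) (Equiv.swap i j)
  rw [image_swap_erase hi hj] at h' this
  have hc := h'.card_filter_deleteLeaf (Finset.notMem_erase i A) j
  rw [Finset.insert_erase hi, this, Finset.filter_image, Finset.card_image_of_injective] at hc
  · simp only [reducedShape_eq, image_image_swap_eq_iff]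
    rw [hc]
    congr 1
    refine Finset.filter_congr fun E hE => ?_
    rw [h.sibling_image hE]
  · exact Finset.image_injective (Equiv.injective _)

theorem minLabel_le_of_mem {x : ℕ} (hx : x ∈ E) : minLabel E ≤ x :=
  Nat.sInf_le hx

theorem minLabel_mem (hE : E.Nonempty) : minLabel E ∈ E :=
  Nat.sInf_mem (s := (E : Set ℕ)) hE

theorem minLabel_empty : minLabel ∅ = 0 := by
  simp [minLabel]

theorem mem_image_swap {x : ℕ} : x ∈ E.image (Equiv.swap i j) ↔ Equiv.swap i j x ∈ E := by
  constructor
  · intro hx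
    obtain ⟨y, hy, rfl⟩ := Finset.mem_image.1 hx
    simpa using hy
  · intro hx
    exact Finset.mem_image.2 ⟨_, hx, by simp⟩

theorem minLabel_image_swap_le_iff {k : ℕ} (hE : E.Nonempty)
    (hEA : E ⊆ (Finset.Icc 1 k).erase j) (hi : i ∈ Finset.Icc 1 j) :
    minLabel (E.image (Equiv.swap i j)) ≤ j ↔ (E ∩ Finset.Icc 1 (j - 1)).Nonempty := by
  have hsub : ∀ x ∈ E, x ≠ j ∧ 1 ≤ x := fun x hx => by
    have := hEA hx
    simp only [Finset.mem_erase, Finset.mem_Icc] at this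
    exact ⟨this.1, this.2.1⟩
  rw [Finset.mem_Icc] at hi
  constructor
  · intro h
    have hm := minLabel_mem (hE.image (Equiv.swap i j))
    generalize minLabel (E.image (Equiv.swap i j)) = m at *
    rw [mem_image_swap] at hm
    refine ⟨_, Finset.mem_inter.2 ⟨hm, ?_⟩⟩
    have := hsub _ hm
    rw [Finset.mem_Icc]
    rw [Equiv.swap_apply_def] at *
    grind
  · rintro ⟨x, hx⟩
    rw [Finset.mem_inter, Finset.mem_Icc] at hx
    refine (minLabel_le_of_mem (Finset.mem_image_of_mem _ hx.1)).trans ?_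
    rw [Equiv.swap_apply_def]
    grind

theorem minLabel_image_swap_eq_iff {k : ℕ} (hE : E.Nonempty)
    (hEA : E ⊆ (Finset.Icc 1 k).erase j) (hi : i ∈ Finset.Icc 1 (j - 1)) :
    minLabel (E.image (Equiv.swap i j)) = j ↔ E ∩ Finset.Icc 1 (j - 1) = {i} := by
  have hsub : ∀ x ∈ E, x ≠ j ∧ 1 ≤ x := fun x hx => by
    have := hEA hx
    simp only [Finset.mem_erase, Finset.mem_Icc] at this
    exact ⟨this.1, this.2.1⟩
  have hi' := Finset.mem_Icc.1 hi
  have hm := minLabel_mem (hE.image (Equiv.swap i j))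
  have hmin : ∀ x ∈ E, minLabel (E.image (Equiv.swap i j)) ≤ Equiv.swap i j x :=
    fun x hx => minLabel_le_of_mem (Finset.mem_image_of_mem _ hx)
  generalize minLabel (E.image (Equiv.swap i j)) = m at *
  rw [mem_image_swap] at hm
  constructor
  · rintro rfl
    rw [Equiv.swap_apply_right] at hm
    ext x
    rw [Finset.mem_inter, Finset.mem_singleton, Finset.mem_Icc]
    constructor
    · rintro ⟨hx, hx1, hx2⟩
      have := hmin x hx
      rw [Equiv.swap_apply_def] at this
      grind
    · rintro rfl
      exact ⟨hm, hi'⟩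
  · intro h
    have hiE : i ∈ E := Finset.mem_of_mem_inter_left (h ▸ Finset.mem_singleton_self i)
    have h1 := hmin i hiE
    rw [Equiv.swap_apply_left] at h1
    refine h1.antisymm (not_lt.1 fun hlt => ?_)
    have h2 := hsub _ hm
    have h3 : Equiv.swap i j m = m ∨ m = i := by
      rw [Equiv.swap_apply_def]
      grind
    rcases h3 with h3 | rfl
    · rw [h3] at hm h2
      have : m ∈ E ∩ Finset.Icc 1 (j - 1) := by
        rw [Finset.mem_inter, Finset.mem_Icc]
        exact ⟨hm, by omega⟩
      rw [h, Finset.mem_singleton] at this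
      subst this
      rw [Equiv.swap_apply_left] at h3
      omega
    · rw [Equiv.swap_apply_left] at h2
      exact h2.1 rfl

/-- The number of leaves `i` for which inserting `i` on the edge `C` with sibling `D`, after
relabelling `i` by `j`, yields a tree shape from which the label `j` is dropped. -/
def dropCount (k j : ℕ) (C D : Finset ℕ) : ℕ :=
  ((Finset.Icc 1 k).filter fun i => max i (max (minLabel (C.image (Equiv.swap i j)))
    (minLabel (D.image (Equiv.swap i j)))) = j).card

theorem dropCount_eq {k : ℕ} {C D : Finset ℕ} (hj : 2 ≤ j) (hjk : j ≤ k)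
    (hC : C.Nonempty) (hD : D.Nonempty) (hCA : C ⊆ (Finset.Icc 1 k).erase j)
    (hDA : D ⊆ (Finset.Icc 1 k).erase j) (hCD : Disjoint C D) :
    dropCount k j C D =
      if (C ∩ Finset.Icc 1 (j - 1)).card = 0 ∨ (D ∩ Finset.Icc 1 (j - 1)).card = 0 then 0
      else 1 + (if (C ∩ Finset.Icc 1 (j - 1)).card = 1 then 1 else 0) +
        (if (D ∩ Finset.Icc 1 (j - 1)).card = 1 then 1 else 0) := by
  have hle : ∀ i ∈ Finset.Icc 1 j, max i (max (minLabel (C.image (Equiv.swap i j)))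
      (minLabel (D.image (Equiv.swap i j)))) = j ↔
      ((C ∩ Finset.Icc 1 (j - 1)).Nonempty ∧ (D ∩ Finset.Icc 1 (j - 1)).Nonempty) ∧
      (i = j ∨ C ∩ Finset.Icc 1 (j - 1) = {i} ∨ D ∩ Finset.Icc 1 (j - 1) = {i}) := by
    intro i hi
    rw [← minLabel_image_swap_le_iff hC hCA hi, ← minLabel_image_swap_le_iff hD hDA hi]
    rcases eq_or_ne i j with rfl | hij
    · omega
    · rw [Finset.mem_Icc] at hi
      have hi' : i ∈ Finset.Icc 1 (j - 1) := by rw [Finset.mem_Icc]; omega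
      rw [← minLabel_image_swap_eq_iff hC hCA hi', ← minLabel_image_swap_eq_iff hD hDA hi']
      omega
  have hfil : dropCount k j C D = ((Finset.Icc 1 j).filter fun i =>
      ((C ∩ Finset.Icc 1 (j - 1)).Nonempty ∧ (D ∩ Finset.Icc 1 (j - 1)).Nonempty) ∧
      (i = j ∨ C ∩ Finset.Icc 1 (j - 1) = {i} ∨ D ∩ Finset.Icc 1 (j - 1) = {i})).card := by
    rw [dropCount]
    congr 1
    ext i
    rw [Finset.mem_filter, Finset.mem_filter]
    constructor
    · rintro ⟨hi, h⟩
      have hi' : i ∈ Finset.Icc 1 j := by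
        rw [Finset.mem_Icc] at hi ⊢
        omega
      exact ⟨hi', (hle i hi').1 h⟩
    · rintro ⟨hi, h⟩
      exact ⟨Finset.Icc_subset_Icc_right hjk hi, (hle i hi).2 h⟩
  rw [hfil]
  have hX : ∀ F : Finset ℕ, F ∩ Finset.Icc 1 (j - 1) ⊆ Finset.Icc 1 (j - 1) :=
    fun F => Finset.inter_subset_right
  have hdis : Disjoint (C ∩ Finset.Icc 1 (j - 1)) (D ∩ Finset.Icc 1 (j - 1)) :=
    (hCD.mono_left Finset.inter_subset_left).mono_right Finset.inter_subset_left
  have hXC := hX C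
  have hXD := hX D
  generalize C ∩ Finset.Icc 1 (j - 1) = U at *
  generalize D ∩ Finset.Icc 1 (j - 1) = V at *
  split_ifs with h0 hU hV hV
  · rw [Finset.card_eq_zero, Finset.filter_eq_empty_iff]
    simp only [Finset.card_eq_zero] at h0
    rcases h0 with rfl | rfl <;> simp
  all_goals
    rw [not_or, ← ne_eq, ← ne_eq, Finset.card_ne_zero, Finset.card_ne_zero] at h0
    simp only [h0, true_and]
  · obtain ⟨u, rfl⟩ := Finset.card_eq_one.1 hU
    obtain ⟨v, rfl⟩ := Finset.card_eq_one.1 hV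
    simp only [Finset.singleton_subset_iff, Finset.mem_Icc, Finset.disjoint_singleton] at *
    rw [show (Finset.Icc 1 j).filter _ = {j, u, v} by
      ext x; simp only [Finset.mem_filter, Finset.mem_Icc, Finset.mem_insert,
        Finset.mem_singleton, Finset.singleton_inj]; omega]
    rw [Finset.card_eq_three.2 ⟨j, u, v, by omega, by omega, by omega, rfl⟩]
  · obtain ⟨u, rfl⟩ := Finset.card_eq_one.1 hU
    have hV' : ∀ x, V ≠ {x} := fun x hx => hV (hx ▸ Finset.card_singleton x)
    simp only [Finset.singleton_subset_iff, Finset.mem_Icc] at *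
    rw [show (Finset.Icc 1 j).filter _ = {j, u} by
      ext x; simp only [Finset.mem_filter, Finset.mem_Icc, Finset.mem_insert,
        Finset.mem_singleton, Finset.singleton_inj, hV', or_false]; omega]
    rw [Finset.card_pair (by omega)]
  · obtain ⟨v, rfl⟩ := Finset.card_eq_one.1 hV
    have hU' : ∀ x, U ≠ {x} := fun x hx => hU (hx ▸ Finset.card_singleton x)
    simp only [Finset.singleton_subset_iff, Finset.mem_Icc] at *
    rw [show (Finset.Icc 1 j).filter _ = {j, v} by
      ext x; simp only [Finset.mem_filter, Finset.mem_Icc, Finset.mem_insert,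
        Finset.mem_singleton, Finset.singleton_inj, hU', false_or]; omega]
    rw [Finset.card_pair (by omega)]
  · have hU' : ∀ x, U ≠ {x} := fun x hx => hU (hx ▸ Finset.card_singleton x)
    have hV' : ∀ x, V ≠ {x} := fun x hx => hV (hx ▸ Finset.card_singleton x)
    rw [show (Finset.Icc 1 j).filter _ = {j} by
      ext x; simp only [Finset.mem_filter, Finset.mem_Icc,
        Finset.mem_singleton, hU', hV', or_false]; omega]
    rw [Finset.card_singleton]

theorem erase_inter_Icc {k : ℕ} (hjk : j ≤ k) :
    (Finset.Icc 1 k).erase j ∩ Finset.Icc 1 (j - 1) = Finset.Icc 1 (j - 1) := by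
  refine Finset.inter_eq_right.2 fun x hx => ?_
  rw [Finset.mem_erase, Finset.mem_Icc]
  rw [Finset.mem_Icc] at hx
  omega

theorem dropCount_root {k : ℕ} (hj : 2 ≤ j) (hjk : j ≤ k) :
    dropCount k j ((Finset.Icc 1 k).erase j) ∅ = if j = 2 then 2 else 1 := by
  have hne : ((Finset.Icc 1 k).erase j).Nonempty :=
    ⟨1, by rw [Finset.mem_erase, Finset.mem_Icc]; omega⟩
  have hmem : ∀ i, (i ∈ Finset.Icc 1 k ∧ max i (max (minLabel
      (((Finset.Icc 1 k).erase j).image (Equiv.swap i j)))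
      (minLabel ((∅ : Finset ℕ).image (Equiv.swap i j)))) = j) ↔ i = j ∨ (i = 1 ∧ j = 2) := by
    intro i
    rw [Finset.image_empty, minLabel_empty, Finset.mem_Icc]
    rcases lt_trichotomy i j with hij | rfl | hij
    · by_cases hi1 : 1 ≤ i
      · have hi' : i ∈ Finset.Icc 1 (j - 1) := by rw [Finset.mem_Icc]; omega
        have h1 := minLabel_image_swap_eq_iff hne subset_rfl hi'
        rw [erase_inter_Icc hjk] at h1
        have h2 : Finset.Icc 1 (j - 1) = {i} ↔ i = 1 ∧ j = 2 := by
          constructor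
          · intro h
            have h3 : 1 ∈ Finset.Icc 1 (j - 1) := by rw [Finset.mem_Icc]; omega
            have h4 : j - 1 ∈ Finset.Icc 1 (j - 1) := by rw [Finset.mem_Icc]; omega
            rw [h, Finset.mem_singleton] at h3 h4
            omega
          · rintro ⟨rfl, rfl⟩
            simp
        rw [h2] at h1
        omega
      · omega
    · have := (minLabel_image_swap_le_iff (i := i) hne subset_rfl
        (by rw [Finset.mem_Icc]; omega)).2 (by rw [erase_inter_Icc hjk]; simp; omega)
      omega
    · omega
  rw [dropCount]
  split_ifs with h
  · rw [show Finset.filter _ _ = {j, 1} by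
      ext x; rw [Finset.mem_filter, hmem, Finset.mem_insert, Finset.mem_singleton]; omega]
    exact Finset.card_pair (by omega)
  · rw [show Finset.filter _ _ = {j} by
      ext x; rw [Finset.mem_filter, hmem, Finset.mem_singleton]; omega]
    exact Finset.card_singleton _

/-- The number of preimages under the swap-and-reduce map of a tree shape in which the label
`j` has been dropped. -/
def fiberCount (j : ℕ) : ℕ := if j = 2 then 2 else 4 * j - 5

theorem IsTreeShape.sum_dropCount {k : ℕ} {s : Finset (Finset ℕ)} (hj : 2 ≤ j) (hjk : j ≤ k)
    (h : IsTreeShape ((Finset.Icc 1 k).erase j) s) :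
    ∑ E ∈ edges ((Finset.Icc 1 k).erase j) s, dropCount k j E (sibling s E) =
      fiberCount j := by
  have hroot := h.ground_mem_edges
  have hsum := h.sum_sibling
    (fun F => if (F ∩ Finset.Icc 1 (j - 1)).card ≤ 1 then 0
      else 4 * (F ∩ Finset.Icc 1 (j - 1)).card - 2) (dropCount k j)
    (fun a _ => if_pos ((Finset.card_le_card Finset.inter_subset_left).trans
      (Finset.card_singleton a).le)) ?_ _ _ hroot rfl
  · have hsplit : edges ((Finset.Icc 1 k).erase j) s =
        insert ((Finset.Icc 1 k).erase j) ((edges ((Finset.Icc 1 k).erase j) s).filter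
          (· ⊂ (Finset.Icc 1 k).erase j)) := by
      ext E
      rw [Finset.mem_insert, Finset.mem_filter]
      constructor
      · intro hE
        rcases eq_or_ne E ((Finset.Icc 1 k).erase j) with h1 | h1
        · exact Or.inl h1
        · exact Or.inr ⟨hE, Finset.ssubset_iff_subset_ne.2 ⟨h.subset_of_mem_edges hE, h1⟩⟩
      · rintro (rfl | hE)
        · exact hroot
        · exact hE.1
    rw [hsplit, Finset.sum_insert (by simp), hsum, h.sibling_ground, dropCount_root hj hjk,
      erase_inter_Icc hjk, Nat.card_Icc, fiberCount]
    split_ifs <;> omega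
  · intro C hC D hD hCD
    have hC' := h.nonempty_of_mem_edges hC
    have hD' := h.nonempty_of_mem_edges hD
    have hCs := h.subset_of_mem_edges hC
    have hDs := h.subset_of_mem_edges hD
    rw [dropCount_eq hj hjk hC' hD' hCs hDs hCD, dropCount_eq hj hjk hD' hC' hDs hCs hCD.symm,
      Finset.union_inter_distrib_right, Finset.card_union_of_disjoint
        ((hCD.mono_left Finset.inter_subset_left).mono_right Finset.inter_subset_left)]
    split_ifs <;> omega

theorem card_fiber {k : ℕ} {s : Finset (Finset ℕ)} (hj : 2 ≤ j) (hjk : j ≤ k)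
    (hs : s ∈ shapesOn ((Finset.Icc 1 k).erase j)) :
    ((shapesOn (Finset.Icc 1 k) ×ˢ Finset.Icc 1 k).filter fun p =>
      Jmap (Finset.Icc 1 k) p.1 p.2 = j ∧ reducedShape p.1 p.2 j = s).card = fiberCount j := by
  rw [mem_shapesOn] at hs
  have hjA : j ∈ Finset.Icc 1 k := by rw [Finset.mem_Icc]; omega
  rw [← hs.sum_dropCount hj hjk, Finset.card_filter, Finset.sum_product_right]
  simp only [dropCount, Finset.card_filter]
  conv_rhs => rw [Finset.sum_comm]
  refine Finset.sum_congr rfl fun i hi => ?_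
  have := card_filter_reducedShape hi hjA hs
  rwa [Finset.card_filter, Finset.card_filter] at this

theorem card_filter_Jmap {k : ℕ} (hj : 2 ≤ j) (hjk : j ≤ k) :
    ((shapesOn (Finset.Icc 1 k) ×ˢ Finset.Icc 1 k).filter fun p =>
      Jmap (Finset.Icc 1 k) p.1 p.2 = j).card =
    (shapesOn ((Finset.Icc 1 k).erase j)).card * fiberCount j := by
  have hjA : j ∈ Finset.Icc 1 k := by rw [Finset.mem_Icc]; omega
  rw [Finset.card_eq_sum_card_fiberwise (f := fun p => reducedShape p.1 p.2 j)
    (t := shapesOn ((Finset.Icc 1 k).erase j)), ← smul_eq_mul]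
  · refine Finset.sum_const_nat fun s hs => ?_
    rw [Finset.filter_filter, card_fiber hj hjk hs]
  · rintro ⟨t, i⟩ hp
    rw [Finset.mem_coe, Finset.mem_filter, Finset.mem_product, mem_shapesOn] at hp
    change reducedShape t i j ∈ _
    rw [Finset.mem_coe, mem_shapesOn, reducedShape_eq, Equiv.swap_comm,
      ← image_swap_erase hjA hp.1.2]
    exact (hp.1.1.deleteLeaf hp.1.2 (by rw [Nat.card_Icc]; omega)).image _

theorem Jmap_mem_Icc {k : ℕ} (hk : 2 ≤ k) (h : IsTreeShape (Finset.Icc 1 k) t)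
    (hi : i ∈ Finset.Icc 1 k) : Jmap (Finset.Icc 1 k) t i ∈ Finset.Icc 2 k := by
  have hcard : 2 ≤ (Finset.Icc 1 k).card := by rw [Nat.card_Icc]; omega
  have hle : ∀ E, E ⊆ Finset.Icc 1 k → minLabel E ≤ k := by
    intro E hE
    rcases E.eq_empty_or_nonempty with rfl | hne
    · simp [minLabel_empty]
    · exact (Finset.mem_Icc.1 (hE (minLabel_mem hne))).2
  have hsub : ∀ E, sibling t E ⊆ Finset.Icc 1 k := fun E =>
    (Finset.sdiff_subset.trans (Finset.filter_subset _ _)).trans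
      (Finset.sup_le h.subset_ground)
  have hm := h.sibling_leaf_mem_edges_deleteLeaf hi hcard
  have hd := h.deleteLeaf hi hcard
  have h1 := hd.subset_of_mem_edges hm (minLabel_mem (hd.nonempty_of_mem_edges hm))
  have h2 := hle _ (hsub {i})
  have h3 := hle _ (hsub (parentEdge t {i}))
  rw [h.Jmap_eq]
  rw [Finset.mem_erase, Finset.mem_Icc] at h1
  rw [Finset.mem_Icc] at hi ⊢
  omega

theorem sum_fiberCount {k : ℕ} (hk : 2 ≤ k) :
    ∑ j ∈ Finset.Icc 2 k, (fiberCount j : ℚ) = k * (2 * k - 3) := by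
  induction k, hk using Nat.le_induction with
  | base => norm_num [fiberCount]
  | succ n hn ih =>
    rw [Finset.sum_Icc_succ_top (by omega), ih, fiberCount, if_neg (by omega),
      Nat.cast_sub (by omega)]
    push_cast
    ring

/-- The double count `k · #𝕋^shape_{[k]} = k (2k - 3) · #𝕋^shape_{[k] ∖ {j}}`. -/
theorem card_shapesOn_mul {k : ℕ} (hk : 2 ≤ k) (hj : j ∈ Finset.Icc 1 k) :
    ((shapesOn (Finset.Icc 1 k) ×ˢ Finset.Icc 1 k).card : ℚ) =
      (shapesOn ((Finset.Icc 1 k).erase j)).card * (k * (2 * k - 3)) := by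
  rw [← sum_fiberCount hk, Finset.mul_sum,
    Finset.card_eq_sum_card_fiberwise (f := fun p => Jmap (Finset.Icc 1 k) p.1 p.2)
      (t := Finset.Icc 2 k)]
  · rw [Nat.cast_sum]
    refine Finset.sum_congr rfl fun i hi => ?_
    rw [Finset.mem_Icc] at hi
    rw [card_filter_Jmap hi.1 hi.2, Nat.cast_mul,
      card_shapesOn_erase (by rw [Finset.mem_Icc]; omega) hj]
  · rintro ⟨t, i⟩ hp
    rw [Finset.mem_coe, Finset.mem_product, mem_shapesOn] at hp
    exact Jmap_mem_Icc hk hp.1 hp.2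

theorem Jmap_probability {k : ℕ} (hj : 2 ≤ j) (hjk : j ≤ k) :
    (((shapesOn (Finset.Icc 1 k) ×ˢ Finset.Icc 1 k).filter fun p =>
      Jmap (Finset.Icc 1 k) p.1 p.2 = j).card : ℚ) /
        ((shapesOn (Finset.Icc 1 k) ×ˢ Finset.Icc 1 k).card : ℚ) =
      fiberCount j / (k * (2 * k - 3)) := by
  have hjA : j ∈ Finset.Icc 1 k := by rw [Finset.mem_Icc]; omega
  have hpos : ((shapesOn ((Finset.Icc 1 k).erase j)).card : ℚ) ≠ 0 := by
    have : ((Finset.Icc 1 k).erase j).Nonempty :=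
      ⟨1, by rw [Finset.mem_erase, Finset.mem_Icc]; omega⟩
    exact_mod_cast (shapesOn_nonempty this).card_ne_zero
  rw [card_filter_Jmap hj hjk, card_shapesOn_mul (hj.trans hjk) hjA, Nat.cast_mul,
    mul_div_mul_left _ _ hpos]

/-- **Distribution of the label dropped by the swap-and-reduce map at a uniform leaf of a
uniform tree shape.**  With `τ` uniform on `𝕋^shape_{[k]}` and, independently, `I` uniform
on `[k]` (modelled by the uniform distribution on `Ω = 𝕋^shape_{[k]} × [k]`), and
`J = J(τ, I)`: `ℙ(J = 1) = 0`, `ℙ(J = 2) = 2/(k(2k−3))`,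
`ℙ(J = j) = (4j−5)/(k(2k−3))` for `3 ≤ j ≤ k`; and conditionally given `{J = j}`, the
reduced tree shape `ϱ̃(τ, I)` is uniform on `𝕋^shape_{[k]∖{j}}` (expressed by saying that
each `s ∈ 𝕋^shape_{[k]∖{j}}` has conditional probability `1/#𝕋^shape_{[k]∖{j}}`). -/
theorem J_distribution_uniform (k : ℕ) (hk : 2 ≤ k)
    (A : Finset ℕ) (hA : A = Finset.Icc 1 k)
    (Ω : Finset (Finset (Finset ℕ) × ℕ)) (hΩ : Ω = (shapesOn A) ×ˢ A) :
    ((Ω.filter fun p => Jmap A p.1 p.2 = 1).card : ℚ) / (Ω.card : ℚ) = 0 ∧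
    ((Ω.filter fun p => Jmap A p.1 p.2 = 2).card : ℚ) / (Ω.card : ℚ)
      = 2 / ((k : ℚ) * (2 * (k : ℚ) - 3)) ∧
    (∀ j : ℕ, 3 ≤ j → j ≤ k →
      ((Ω.filter fun p => Jmap A p.1 p.2 = j).card : ℚ) / (Ω.card : ℚ)
        = (4 * (j : ℚ) - 5) / ((k : ℚ) * (2 * (k : ℚ) - 3))) ∧
    (∀ j : ℕ, 2 ≤ j → j ≤ k → ∀ s ∈ shapesOn (A.erase j),
      ((Ω.filter fun p => Jmap A p.1 p.2 = j ∧ reducedShape p.1 p.2 j = s).card : ℚ)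
          * ((shapesOn (A.erase j)).card : ℚ)
        = ((Ω.filter fun p => Jmap A p.1 p.2 = j).card : ℚ)) := by
  subst hA hΩ
  refine ⟨?_, ?_, ?_, ?_⟩
  · rw [Finset.card_eq_zero.2 (Finset.filter_eq_empty_iff.2 ?_)]
    · simp
    · rintro ⟨t, i⟩ hp h1
      rw [Finset.mem_product, mem_shapesOn] at hp
      have := Jmap_mem_Icc hk hp.1 hp.2
      rw [h1, Finset.mem_Icc] at this
      omega
  · rw [Jmap_probability le_rfl hk]
    simp [fiberCount]
  · intro j hj hjk
    rw [Jmap_probability (by omega) hjk, fiberCount, if_neg (by omega), Nat.cast_sub (by omega)]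
    push_cast
    rfl
  · intro j hj hjk s hs
    rw [card_fiber hj hjk hs, card_filter_Jmap hj hjk, Nat.cast_mul, mul_comm]

end

end AldousTrees
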